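/- Let X ⊆ ℝ^m be nonempty and compact, let F, f : ℝ^m × ℝ^n → ℝ be continuous, and let y* : X → ℝ^n be continuous such that for each x ∈ X the point y*(x) is the unique minimizer of y ↦ f(x, y) over ℝ^n (the lower-level singleton condition). Suppose maps y_T : X → ℝ^n converge to y* uniformly on X. Define φ(x) := F(x, y*(x)) and φ_T(x) := F(x, y_T(x)), and suppose that for each T a global minimizer x_T of φ_T over X exists. Then every limit point x̄ of {x_T} is a global minimizer of φ over X, and inf_{x ∈ X} φ_T(x) → inf_{x ∈ X} φ(x) as T → ∞. -/

import Mathlib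

open Filter Topology

/-- Under the lower-level singleton condition, if `y_T → y*` uniformly on the nonempty
compact set `X` and each `φ_T(x) := F(x, y_T(x))` has a global minimizer `x_T` over `X`,
then every limit point of `{x_T}` is a global minimizer of `φ(x) := F(x, y*(x))` over
`X`, and `inf_{x ∈ X} φ_T(x) → inf_{x ∈ X} φ(x)`. -/
theorem statement12 {m n : ℕ}
    (X : Set (EuclideanSpace ℝ (Fin m))) (hXne : X.Nonempty) (hXcp : IsCompact X)
    (F f : EuclideanSpace ℝ (Fin m) × EuclideanSpace ℝ (Fin n) → ℝ)
    (hF : Continuous F) (hf : Continuous f)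
    (ystar : EuclideanSpace ℝ (Fin m) → EuclideanSpace ℝ (Fin n))
    (hystar : ContinuousOn ystar X)
    -- lower-level singleton condition: y*(x) is the unique minimizer of f(x, ·)
    (hLLS : ∀ x ∈ X, ∀ y : EuclideanSpace ℝ (Fin n),
      y ≠ ystar x → f (x, ystar x) < f (x, y))
    (yT : ℕ → EuclideanSpace ℝ (Fin m) → EuclideanSpace ℝ (Fin n))
    (hunif : TendstoUniformlyOn (fun T x => yT T x) ystar atTop X)
    (xT : ℕ → EuclideanSpace ℝ (Fin m))
    -- each x_T is a global minimizer of φ_T over X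
    (hxT : ∀ T : ℕ, xT T ∈ X ∧ ∀ x ∈ X, F (xT T, yT T (xT T)) ≤ F (x, yT T x)) :
    (∀ xbar : EuclideanSpace ℝ (Fin m), MapClusterPt xbar atTop xT →
      xbar ∈ X ∧ ∀ x ∈ X, F (xbar, ystar xbar) ≤ F (x, ystar x)) ∧
    Tendsto (fun T => ⨅ x : X, F ((x : EuclideanSpace ℝ (Fin m)), yT T x))
      atTop (𝓝 (⨅ x : X, F ((x : EuclideanSpace ℝ (Fin m)), ystar x))) := by
  have key : ∀ ε > 0, ∀ᶠ T in atTop, ∀ x ∈ X, |F (x, ystar x) - F (x, yT T x)| < ε := by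
    intro ε hε
    have hK : IsCompact (Set.image (fun x => (x, ystar x)) X) :=
      hXcp.image_of_continuousOn (continuousOn_id.prodMk hystar)
    have h1 := hK.uniformContinuousAt_of_continuousAt F
      (fun a _ => hF.continuousAt) (Metric.dist_mem_uniformity hε)
    obtain ⟨δ, hδ, h2⟩ := Metric.mem_uniformity_dist.1 h1
    filter_upwards [Metric.tendstoUniformlyOn_iff.1 hunif δ hδ] with T hT x hx
    have h3 : dist (x, ystar x) (x, yT T x) < δ := by
      rw [Prod.dist_eq]
      simpa [hδ] using hT x hx
    have h4 := h2 h3 ⟨x, hx, rfl⟩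
    simpa [Real.dist_eq] using h4
  have hφ : ContinuousOn (fun x => F (x, ystar x)) X :=
    hF.comp_continuousOn (continuousOn_id.prodMk hystar)
  constructor
  · intro xbar hbar
    have hmem : xbar ∈ X := by
      refine hXcp.isClosed.closure_eq ▸ mem_closure_iff_clusterPt.2 (hbar.clusterPt.mono ?_)
      exact le_principal_iff.2 (mem_map.2 (Eventually.of_forall fun T => (hxT T).1))
    refine ⟨hmem, fun x hx => ?_⟩
    by_contra! hlt
    set ε := (F (xbar, ystar xbar) - F (x, ystar x)) / 3 with hε
    have hε0 : 0 < ε := by rw [hε]; linarith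
    have hnear : ∀ᶠ z in 𝓝 xbar, z ∈ X → F (xbar, ystar xbar) - ε < F (z, ystar z) :=
      eventually_nhdsWithin_iff.1
        ((hφ xbar hmem).eventually (lt_mem_nhds (by simp only; linarith)))
    obtain ⟨T, hT1, hT2⟩ := ((hbar.frequently hnear).and_eventually (key ε hε0)).exists
    have a := hT1 (hxT T).1
    have b := abs_lt.1 (hT2 _ (hxT T).1)
    have c := abs_lt.1 (hT2 x hx)
    have d := (hxT T).2 x hx
    linarith [b.1, b.2, c.1, c.2]
  · have hinf : ∀ (g : EuclideanSpace ℝ (Fin m) → ℝ) (x₀ : EuclideanSpace ℝ (Fin m)), x₀ ∈ X →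
        (∀ x ∈ X, g x₀ ≤ g x) → (⨅ x : X, g x) = g x₀ := by
      intro g x₀ h₀ h
      have : Nonempty X := ⟨⟨x₀, h₀⟩⟩
      apply le_antisymm
      · exact ciInf_le (f := fun x : X => g x)
          ⟨g x₀, by rintro _ ⟨x, rfl⟩; exact h x x.2⟩ ⟨x₀, h₀⟩
      · exact le_ciInf fun x => h x x.2
    obtain ⟨x₀, h₀, hmin⟩ := hXcp.exists_isMinOn hXne hφ
    have hmin' : ∀ x ∈ X, F (x₀, ystar x₀) ≤ F (x, ystar x) := fun x hx => hmin hx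
    rw [hinf (fun x => F (x, ystar x)) x₀ h₀ hmin']
    have e : (fun T => ⨅ x : X, F ((x : EuclideanSpace ℝ (Fin m)), yT T x)) =
        fun T => F (xT T, yT T (xT T)) :=
      funext fun T => hinf (fun x => F (x, yT T x)) (xT T) (hxT T).1 (hxT T).2
    rw [e, Metric.tendsto_nhds]
    intro ε hε
    filter_upwards [key ε hε] with T hT
    have b := abs_lt.1 (hT _ (hxT T).1)
    have c := abs_lt.1 (hT x₀ h₀)
    have d := (hxT T).2 x₀ h₀
    have k := hmin' _ (hxT T).1
    rw [Real.dist_eq, abs_lt]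
    constructor <;> linarith [b.1, b.2, c.1, c.2]
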